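/- arXiv:2007.09299 — 3 statements merged into one kernel-verified Lean document; each statement's English description precedes it below -/
import Mathlib

section
/- Let n, N ≥ 1, A ∈ ℝ^{n×N}, K ⊆ {1,…,N} with |K| ≤ n, and let D̂ ∈ ℝ^{N×N} be the diagonal matrix with D̂_{ii} = 1 if i ∈ K and D̂_{ii} = 0 otherwise. Let e, τ̂ ∈ ℝ with τ̂ ≠ 0, set α = 1 − e/τ̂, let ρ ∈ ℝ, and let ŝ ∈ ℝⁿ. Define the (n+N+1)×(n+N+1) block matrix J = [[(1 − e/τ̂) I_n, (e/τ̂) A, 0_{n×1}], [(e − τ̂) D̂ Aᵀ, D̂(I_N − e AᵀA), −D̂ Aᵀ ŝ], [0_{1×n}, 0_{1×N}, ρ]]. Then for every λ ∈ ℝ, det(J − λ I) = (−1)^{N−|K|} (ρ − λ) λ^{N−|K|} (α − λ)^{n−|K|} · det((α−λ)(1−λ) I_{|K|} + λ e [AᵀA]_K). -/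
open Matrix BigOperators

/-- Masking the rows of `M` outside `K` splits off a power of `c` from `det (c • 1 + M)`. -/
theorem Matrix.det_smul_one_add_diagonal_indicator_mul {ι R : Type*} [Fintype ι] [DecidableEq ι]
    [CommRing R] (K : Finset ι) (c : R) (M : Matrix ι ι R) :
    det (c • (1 : Matrix ι ι R) + diagonal (fun i => if i ∈ K then (1 : R) else 0) * M) =
      c ^ (Fintype.card ι - K.card) *
        det (c • (1 : Matrix K K R) + M.submatrix (fun i : K => (i : ι)) (fun j : K => (j : ι))) := by
  have hc : toSquareBlockProp
      (c • (1 : Matrix ι ι R) + diagonal (fun i => if i ∈ K then (1 : R) else 0) * M)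
      (fun i => ¬ i ∈ K) = c • 1 := by
    ext ⟨i, hi⟩ ⟨j, hj⟩
    simp [toSquareBlockProp_def, diagonal_mul, hi, one_apply]
  have hK : toSquareBlockProp
      (c • (1 : Matrix ι ι R) + diagonal (fun i => if i ∈ K then (1 : R) else 0) * M)
      (fun i => i ∈ K) =
        c • (1 : Matrix K K R) + M.submatrix (fun i : K => (i : ι)) (fun j : K => (j : ι)) := by
    ext ⟨i, hi⟩ ⟨j, hj⟩
    simp [toSquareBlockProp_def, diagonal_mul, one_apply]
  rw [twoBlockTriangular_det _ (fun i => i ∈ K), hc, hK, det_smul, det_one, mul_one,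
    Fintype.card_subtype_compl, Fintype.card_coe, mul_comm]
  · congr!
  · intro i hi j hj
    have hij : i ≠ j := fun h => hi (h ▸ hj)
    simp [diagonal_mul, hi, hij]

/-- The Schur complement formula for a block matrix whose top left block is a nonzero scalar. -/
theorem Matrix.det_fromBlocks_smul_one {m n F : Type*} [Fintype m] [DecidableEq m] [Fintype n]
    [DecidableEq n] [Field F] {a : F} (ha : a ≠ 0) (B : Matrix m n F) (C : Matrix n m F)
    (D : Matrix n n F) :
    det (fromBlocks (a • (1 : Matrix m m F)) B C D) =
      a ^ Fintype.card m * det (D - a⁻¹ • (C * B)) := by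
  let _ : Invertible (a • (1 : Matrix m m F)) :=
    ⟨a⁻¹ • 1, by simp [smul_smul, ha], by simp [smul_smul, ha]⟩
  have h : ⅟(a • (1 : Matrix m m F)) = a⁻¹ • 1 := rfl
  rw [det_fromBlocks₁₁, h, det_smul, det_one, mul_one]
  simp

/-- characteristic-polynomial factorization of the Jacobian `J` of the
proposed AMP variant at an equilibrium point with support `K`:
`det(J − λI) = (−1)^(N−|K|) (ρ−λ) λ^(N−|K|) (α−λ)^(n−|K|) ·
det((α−λ)(1−λ) I_|K| + λe [AᵀA]_K)` for every real `λ`, where `α = 1 − e/τ̂`. -/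
theorem jacobian_charpoly_factorization
    (n N : ℕ) (hn : 1 ≤ n) (hN : 1 ≤ N)
    (A : Matrix (Fin n) (Fin N) ℝ) (K : Finset (Fin N)) (hK : K.card ≤ n)
    (Dhat : Matrix (Fin N) (Fin N) ℝ)
    (hD : Dhat = Matrix.diagonal (fun i => if i ∈ K then (1 : ℝ) else 0))
    (e τ : ℝ) (hτ : τ ≠ 0) (α : ℝ) (hα : α = 1 - e / τ)
    (ρ : ℝ) (shat : Fin n → ℝ)
    (J : Matrix ((Fin n ⊕ Fin N) ⊕ Unit) ((Fin n ⊕ Fin N) ⊕ Unit) ℝ)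
    (hJ : J = Matrix.fromBlocks
      (Matrix.fromBlocks
        ((1 - e / τ) • (1 : Matrix (Fin n) (Fin n) ℝ))
        ((e / τ) • A)
        ((e - τ) • (Dhat * Aᵀ))
        (Dhat * ((1 : Matrix (Fin N) (Fin N) ℝ) - e • (Aᵀ * A))))
      (Matrix.of fun i (_ : Unit) =>
        Sum.elim (fun _ : Fin n => (0 : ℝ)) (fun j : Fin N => -(((Dhat * Aᵀ) *ᵥ shat) j)) i)
      0
      (Matrix.of fun _ _ => ρ)) :
    ∀ lam : ℝ,
      Matrix.det (J - lam • (1 : Matrix ((Fin n ⊕ Fin N) ⊕ Unit) ((Fin n ⊕ Fin N) ⊕ Unit) ℝ)) =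
      (-1 : ℝ) ^ (N - K.card) * (ρ - lam) * lam ^ (N - K.card) * (α - lam) ^ (n - K.card) *
        Matrix.det (((α - lam) * (1 - lam)) • (1 : Matrix K K ℝ)
          + (lam * e) • (Aᵀ * A).submatrix (fun i : K => (i : Fin N)) (fun j : K => (j : Fin N))) := by
  have hcont : Continuous fun lam : ℝ =>
      Matrix.det (J - lam • (1 : Matrix ((Fin n ⊕ Fin N) ⊕ Unit) ((Fin n ⊕ Fin N) ⊕ Unit) ℝ)) := by
    fun_prop
  refine funext_iff.1 (Continuous.ext_on (dense_compl_singleton α) hcont ?_ ?_)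
  · fun_prop
  intro lam hlam
  have ha : α - lam ≠ 0 := sub_ne_zero.2 (Ne.symm hlam)
  set G := Aᵀ * A with hG
  have hblocks : J - lam • (1 : Matrix ((Fin n ⊕ Fin N) ⊕ Unit) ((Fin n ⊕ Fin N) ⊕ Unit) ℝ) =
      Matrix.fromBlocks
        (Matrix.fromBlocks ((α - lam) • (1 : Matrix (Fin n) (Fin n) ℝ)) ((e / τ) • A)
          ((e - τ) • (Dhat * Aᵀ)) (Dhat * (1 - e • G) - lam • 1))
        (Matrix.of fun i (_ : Unit) =>
          Sum.elim (fun _ : Fin n => (0 : ℝ)) (fun j : Fin N => -(((Dhat * Aᵀ) *ᵥ shat) j)) i)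
        0
        (Matrix.of fun _ _ => ρ - lam) := by
    rw [hJ, ← hα]
    ext ((i | i) | i) ((j | j) | j) <;> simp [Matrix.one_apply, sub_smul]
  have hschur : Dhat * (1 - e • G) - lam • 1 -
      (α - lam)⁻¹ • (((e - τ) • (Dhat * Aᵀ)) * ((e / τ) • A)) =
      (-lam) • (1 : Matrix (Fin N) (Fin N) ℝ) +
        Dhat * (1 + (lam * e * (α - lam)⁻¹) • G) := by
    have hcoef : lam * e * (α - lam)⁻¹ = -e - (α - lam)⁻¹ * ((e - τ) * (e / τ)) := by
      have hα' : (e - τ) * (e / τ) = -e * α := by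
        rw [hα]
        field_simp
        ring
      rw [hα']
      field_simp
      ring
    rw [hcoef]
    simp only [Matrix.smul_mul, Matrix.mul_smul, Matrix.mul_assoc, Matrix.mul_add, Matrix.mul_sub,
      smul_smul, ← hG, Matrix.mul_one]
    module
  have hminor : (α - lam) ^ K.card * Matrix.det ((-lam) • (1 : Matrix K K ℝ) +
        (1 + (lam * e * (α - lam)⁻¹) • G).submatrix (fun i : K => (i : Fin N))
          (fun j : K => (j : Fin N))) =
      Matrix.det (((α - lam) * (1 - lam)) • (1 : Matrix K K ℝ) +
        (lam * e) • G.submatrix (fun i : K => (i : Fin N)) (fun j : K => (j : Fin N))) := by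
    rw [← Fintype.card_coe K, ← Matrix.det_smul]
    congr 1
    ext i j
    simp only [Matrix.smul_apply, Matrix.add_apply, Matrix.submatrix_apply, Matrix.one_apply,
      smul_eq_mul, Subtype.coe_inj]
    field_simp
    ring
  beta_reduce
  rw [hblocks, Matrix.det_fromBlocks_zero₂₁, Matrix.det_fromBlocks_smul_one ha, hschur, hD,
    Matrix.det_smul_one_add_diagonal_indicator_mul, ← hminor, Matrix.det_unique (n := Unit), Matrix.of_apply,
    Fintype.card_fin, Fintype.card_fin, neg_pow, ← pow_sub_mul_pow (α - lam) hK]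
  ring
end

section
/- Let N ≥ 1, K ⊆ {1,…,N}, and let D̂ ∈ ℝ^{N×N} be the diagonal matrix with D̂_{ii} = 1 if i ∈ K and D̂_{ii} = 0 otherwise. Let M ∈ ℝ^{N×N} be any matrix and let α, e, λ ∈ ℝ. Then det((α−λ) D̂ − (α−λ)λ I_N + λ e D̂ M) = (−λ(α−λ))^{N−|K|} · det((α−λ)(1−λ) I_{|K|} + λ e [M]_K). -/
open Matrix BigOperators

/-- determinant identity obtained by expanding along the rows outside `K`:
`det((α−λ)D̂ − (α−λ)λ I_N + λe D̂M) = (−λ(α−λ))^(N−|K|) · det((α−λ)(1−λ) I_|K| + λe [M]_K)`,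
where `D̂` is the 0/1 diagonal matrix of the index set `K` and `[M]_K` is the principal
submatrix of `M` on `K`. -/
theorem det_diagonal_mask_identity
    (N : ℕ) (hN : 1 ≤ N) (K : Finset (Fin N))
    (Dhat : Matrix (Fin N) (Fin N) ℝ)
    (hD : Dhat = Matrix.diagonal (fun i => if i ∈ K then (1 : ℝ) else 0))
    (M : Matrix (Fin N) (Fin N) ℝ) (α e lam : ℝ) :
    Matrix.det ((α - lam) • Dhat - ((α - lam) * lam) • (1 : Matrix (Fin N) (Fin N) ℝ)
        + (lam * e) • (Dhat * M)) =
    (-(lam * (α - lam))) ^ (N - K.card) *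
      Matrix.det (((α - lam) * (1 - lam)) • (1 : Matrix K K ℝ)
        + (lam * e) • M.submatrix (fun i : K => (i : Fin N)) (fun j : K => (j : Fin N))) := by
  subst hD
  rw [twoBlockTriangular_det _ (· ∈ K), mul_comm]
  · congr 1
    · have hblock : toSquareBlockProp ((α - lam) • diagonal (fun i => if i ∈ K then (1 : ℝ) else 0)
          - ((α - lam) * lam) • (1 : Matrix (Fin N) (Fin N) ℝ)
          + (lam * e) • (diagonal (fun i => if i ∈ K then (1 : ℝ) else 0) * M)) (fun i => i ∉ K)
          = diagonal (fun _ => -(lam * (α - lam))) := by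
        ext ⟨i, hi⟩ ⟨j, hj⟩
        by_cases hij : i = j
        · subst hij
          simp [toSquareBlockProp_def, hi, diagonal_mul]
          ring
        · simp [toSquareBlockProp_def, hi, diagonal_mul, hij]
      rw [hblock, det_diagonal, Finset.prod_const, Finset.card_univ, Fintype.card_subtype_compl]
      simp
    · convert rfl using 2
      ext ⟨i, hi⟩ ⟨j, hj⟩
      by_cases hij : i = j
      · subst hij
        simp [toSquareBlockProp_def, hi, diagonal_mul]
        ring
      · simp [toSquareBlockProp_def, diagonal_mul, hij]
  · intro i hi j hj
    have hij : i ≠ j := fun h => hi (h ▸ hj)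
    simp [hi, diagonal_mul, hij]
end

section
/- Let A ∈ ℝ^{n×N}, y ∈ ℝⁿ, γ > 0, τ̂ > 0, e > 0. Suppose (ŝ, x̂) ∈ ℝⁿ × ℝ^N is a fixed point of the proposed AMP variant's updates, i.e., ŝ = (e/τ̂)(A x̂ − y) + (1 − e/τ̂) ŝ and x̂ = η(x̂ − τ̂ Aᵀ ŝ; γ τ̂). Then x̂ is a minimizer of the LASSO objective: F(x̂) ≤ F(x) for all x ∈ ℝ^N. -/
open Matrix BigOperators

/-- Soft-thresholding operator `η(u;θ)ᵢ = sign(uᵢ)·max(|uᵢ|−θ, 0)`. -/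
noncomputable def eta {N : ℕ} (u : Fin N → ℝ) (θ : ℝ) : Fin N → ℝ :=
  fun i => Real.sign (u i) * max (|u i| - θ) 0

/-- The soft-thresholded value `p` of `u` satisfies `u - p ∈ θ ∂|·|(p)`. -/
theorem softThreshold_subgradient {u θ p : ℝ} (hθ : 0 ≤ θ)
    (hp : p = Real.sign u * max (|u| - θ) 0) (z : ℝ) :
    (u - p) * (z - p) ≤ θ * (|z| - |p|) := by
  rcases le_total |u| θ with h | h
  · rw [max_eq_right (by linarith), mul_zero] at hp
    subst hp
    calc (u - 0) * (z - 0) ≤ |u| * |z| := by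
          rw [sub_zero, sub_zero, ← abs_mul]; exact le_abs_self _
      _ ≤ θ * (|z| - |0|) := by
          rw [abs_zero, sub_zero]; gcongr
  · rw [max_eq_left (by linarith)] at hp
    rcases lt_trichotomy u 0 with hu | rfl | hu
    · rw [Real.sign_of_neg hu, abs_of_neg hu] at hp
      rw [abs_of_neg hu] at h
      rw [abs_of_nonpos (by linarith : p ≤ 0), show u - p = -θ by linarith]
      nlinarith [mul_le_mul_of_nonneg_left (neg_le_abs z) hθ]
    · rw [Real.sign_zero, zero_mul] at hp
      subst hp
      simpa using mul_nonneg hθ (abs_nonneg z)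
    · rw [Real.sign_of_pos hu, abs_of_pos hu] at hp
      rw [abs_of_pos hu] at h
      rw [abs_of_nonneg (by linarith : 0 ≤ p), show u - p = θ by linarith]
      nlinarith [mul_le_mul_of_nonneg_left (le_abs_self z) hθ]

/-- any fixed point `(ŝ, x̂)` of the proposed AMP variant's updates has
`x̂` a minimizer of the LASSO objective `F(x) = (1/2)‖y − Ax‖₂² + γ‖x‖₁`. -/
theorem fixed_point_of_AMP_variant_is_lasso_minimizer
    (n N : ℕ) (A : Matrix (Fin n) (Fin N) ℝ) (y : Fin n → ℝ)
    (γ τ e : ℝ) (hγ : 0 < γ) (hτ : 0 < τ) (he : 0 < e)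
    (shat : Fin n → ℝ) (xhat : Fin N → ℝ)
    (hs : shat = (e / τ) • (A *ᵥ xhat - y) + (1 - e / τ) • shat)
    (hx : xhat = eta (xhat - τ • (Aᵀ *ᵥ shat)) (γ * τ)) :
    ∀ x : Fin N → ℝ,
      (1 / 2) * (∑ i, (y i - (A *ᵥ xhat) i) ^ 2) + γ * ∑ i, |xhat i| ≤
      (1 / 2) * (∑ i, (y i - (A *ᵥ x) i) ^ 2) + γ * ∑ i, |x i| := by
  intro x
  have hres : ∀ i, shat i = (A *ᵥ xhat) i - y i := fun i => by
    have h := congrFun hs i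
    simp only [Pi.add_apply, Pi.smul_apply, Pi.sub_apply, smul_eq_mul] at h
    have h0 : e / τ * (shat i - ((A *ᵥ xhat) i - y i)) = 0 := by linarith
    have := (mul_eq_zero.mp h0).resolve_left (div_pos he hτ).ne'
    linarith
  have hsub : ∀ j, γ * |xhat j| ≤ γ * |x j| + (Aᵀ *ᵥ shat) j * (x j - xhat j) := fun j => by
    have h := softThreshold_subgradient (mul_pos hγ hτ).le (congrFun hx j) (x j)
    simp only [Pi.sub_apply, Pi.smul_apply, smul_eq_mul] at h
    refine le_of_mul_le_mul_left ?_ hτ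
    linarith
  have hadj : ∑ j, (Aᵀ *ᵥ shat) j * (x j - xhat j) =
      ∑ i, shat i * ((A *ᵥ x) i - (A *ᵥ xhat) i) := by
    have h := dotProduct_mulVec shat A (x - xhat)
    rw [← mulVec_transpose, mulVec_sub] at h
    exact h.symm
  have hl1 : γ * ∑ j, |xhat j| ≤
      γ * ∑ j, |x j| + ∑ i, shat i * ((A *ᵥ x) i - (A *ᵥ xhat) i) := by
    rw [← hadj, Finset.mul_sum, Finset.mul_sum, ← Finset.sum_add_distrib]
    exact Finset.sum_le_sum fun j _ => hsub j
  have hquad : (1 / 2) * (∑ i, (y i - (A *ᵥ xhat) i) ^ 2) +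
      ∑ i, shat i * ((A *ᵥ x) i - (A *ᵥ xhat) i) ≤
      (1 / 2) * (∑ i, (y i - (A *ᵥ x) i) ^ 2) := by
    rw [Finset.mul_sum, Finset.mul_sum, ← Finset.sum_add_distrib]
    refine Finset.sum_le_sum fun i _ => ?_
    rw [hres i]
    nlinarith [sq_nonneg ((A *ᵥ x) i - (A *ᵥ xhat) i)]
  linarith
end
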